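/- Fix p with 1 ≤ p < ∞. There exist constants A, B > 0, depending only on p, such that for every n ≥ 1 there exists a constant C > 0 (depending on p and n) with: 𝒱_{B_p^n}{ x : | |x|/C - 1 | > u } ≤ A·exp(-B·n^{min(p,2)/2}·u^{min(p,2)}) for all u ∈ [0,1]. -/

import Mathlib

open MeasureTheory Real

/-- The normalised volume measure of a convex body `K`:
`𝒱_K(A) = vol(A ∩ K)/vol(K)`. -/
noncomputable def volMeasure {n : ℕ} (K A : Set (EuclideanSpace ℝ (Fin n))) : ℝ :=
  (volume (A ∩ K) / volume K).toReal

/-- The unit ball of `ℓ_p^n`. -/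
def lpBall (n : ℕ) (p : ℝ) : Set (EuclideanSpace ℝ (Fin n)) :=
  {x | ∑ i, |x i| ^ p ≤ 1}

theorem exp_le_one_add_add_sq_mul_exp {y : ℝ} (hy : 0 ≤ y) :
    exp y ≤ 1 + y + y ^ 2 * exp y := by
  have h1 : 1 - y ≤ exp (-y) := by linarith [add_one_le_exp (-y)]
  have h2 : exp (-y) * exp y = 1 := by rw [← exp_add]; simp
  nlinarith [mul_le_mul_of_nonneg_right h1 (mul_nonneg (by linarith : 0 ≤ 1 + y) (exp_pos y).le)]

theorem exp_neg_le_one_sub_add_sq {y : ℝ} (hy : 0 ≤ y) : exp (-y) ≤ 1 - y + y ^ 2 := by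
  have h1 : 1 + y ≤ exp y := by linarith [add_one_le_exp y]
  have h2 : exp (-y) * exp y = 1 := by rw [← exp_add]; simp
  have h3 : exp (-y) * (1 + y) ≤ 1 := by
    exact (mul_le_mul_of_nonneg_left h1 (exp_pos _).le).trans h2.le
  have h4 : 1 ≤ (1 - y + y ^ 2) * (1 + y) := by nlinarith [pow_nonneg hy 3]
  exact le_of_mul_le_mul_right (h3.trans h4) (by linarith)

theorem pow_four_le_exp_div_four {z : ℝ} (hz : 0 ≤ z) : z ^ 4 ≤ 6144 * exp (z / 4) := by
  have h := pow_div_factorial_le_exp (x := z / 4) (by positivity) 4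
  norm_num [Nat.factorial] at h
  linarith

theorem abs_le_one_add_abs_rpow {m : ℝ} (hm : 1 ≤ m) (x : ℝ) : |x| ≤ 1 + |x| ^ m := by
  rcases le_total |x| 1 with h | h
  · linarith [rpow_nonneg (abs_nonneg x) m]
  · linarith [self_le_rpow_of_one_le h hm]

theorem pow_four_le_exp_abs_rpow {m : ℝ} (hm : 1 ≤ m) (x : ℝ) :
    x ^ 4 ≤ 6144 * exp (|x| ^ m / 4) := by
  have hx : x ^ 4 = |x| ^ 4 := by rw [← abs_pow, abs_of_nonneg (by positivity)]
  rw [hx]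
  rcases le_total |x| 1 with h | h
  · have h1 : |x| ^ 4 ≤ 1 := pow_le_one₀ (abs_nonneg x) h
    have h2 : 1 ≤ exp (|x| ^ m / 4) := one_le_exp (by positivity)
    linarith
  · refine (pow_le_pow_left₀ (abs_nonneg x) (self_le_rpow_of_one_le h hm) 4).trans ?_
    exact pow_four_le_exp_div_four (by positivity)

theorem min_sq_le_abs_rpow_mul {m R : ℝ} (hm0 : 0 ≤ m) (hm2 : m ≤ 2) (hR : 0 < R) (x : ℝ) :
    min (x ^ 2) R ≤ |x| ^ m * R ^ (1 - m / 2) := by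
  rcases eq_or_ne x 0 with rfl | hx
  · refine (min_le_left _ _).trans ?_
    simpa using by positivity
  have hy : 0 < min (x ^ 2) R := lt_min (by positivity) hR
  have hxm : (x ^ 2) ^ (m / 2) = |x| ^ m := by
    rw [← sq_abs, ← rpow_natCast, ← rpow_mul (abs_nonneg x)]
    congr 1; push_cast; ring
  calc min (x ^ 2) R = min (x ^ 2) R ^ (m / 2) * min (x ^ 2) R ^ (1 - m / 2) := by
        rw [← rpow_add hy]; simp
    _ ≤ (x ^ 2) ^ (m / 2) * R ^ (1 - m / 2) := by
        gcongr
        · exact min_le_left _ _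
        · linarith
        · exact min_le_right _ _
    _ = _ := by rw [hxm]

section Concentration

variable {ν : Measure ℝ} {m : ℝ}

theorem integrable_sq_of_exp_abs_rpow [IsFiniteMeasure ν] (hm : 1 ≤ m)
    (hν : Integrable (fun x => exp (|x| ^ m / 2)) ν) : Integrable (fun x => x ^ 2) ν := by
  refine (hν.const_mul 6145).mono' (by fun_prop) (Filter.Eventually.of_forall fun x => ?_)
  rw [norm_of_nonneg (by positivity)]
  have h1 := pow_four_le_exp_abs_rpow hm x
  have h0 : 0 ≤ |x| ^ m := by positivity
  have h2 : exp (|x| ^ m / 4) ≤ exp (|x| ^ m / 2) := exp_le_exp.2 (by linarith)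
  have h3 : 1 ≤ exp (|x| ^ m / 2) := one_le_exp (by positivity)
  nlinarith [sq_nonneg (x ^ 2 - 1)]

variable [IsProbabilityMeasure ν]

theorem integral_exp_neg_sq_le (hm : 1 ≤ m)
    (hν : Integrable (fun x => exp (|x| ^ m / 2)) ν) {l : ℝ} (hl : 0 ≤ l) :
    ∫ x, exp (-(l * x ^ 2)) ∂ν ≤
      exp (-(l * ∫ x, x ^ 2 ∂ν) + l ^ 2 * (6144 * ∫ x, exp (|x| ^ m / 2) ∂ν)) := by
  have hsq := integrable_sq_of_exp_abs_rpow hm hν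
  have hlin : Integrable (fun x => 1 - l * x ^ 2) ν :=
    (integrable_const _).sub (hsq.const_mul l)
  have hint : Integrable (fun x => 1 - l * x ^ 2 + l ^ 2 * (6144 * exp (|x| ^ m / 2))) ν :=
    hlin.add ((hν.const_mul _).const_mul _)
  calc ∫ x, exp (-(l * x ^ 2)) ∂ν
      ≤ ∫ x, 1 - l * x ^ 2 + l ^ 2 * (6144 * exp (|x| ^ m / 2)) ∂ν := by
        refine integral_mono_of_nonneg (Filter.Eventually.of_forall fun x => (exp_pos _).le) hint
          (Filter.Eventually.of_forall fun x => ?_)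
        have h0 : 0 ≤ |x| ^ m := by positivity
        have h1 := exp_neg_le_one_sub_add_sq (y := l * x ^ 2) (by positivity)
        have h2 : exp (|x| ^ m / 4) ≤ exp (|x| ^ m / 2) := exp_le_exp.2 (by linarith)
        have h3 : x ^ 4 ≤ 6144 * exp (|x| ^ m / 2) := by
          linarith [pow_four_le_exp_abs_rpow hm x]
        have h4 := mul_le_mul_of_nonneg_left h3 (sq_nonneg l)
        simp only
        linarith [show (l * x ^ 2) ^ 2 = l ^ 2 * x ^ 4 by ring]
    _ = -(l * ∫ x, x ^ 2 ∂ν) + l ^ 2 * (6144 * ∫ x, exp (|x| ^ m / 2) ∂ν) + 1 := by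
        rw [integral_add hlin ((hν.const_mul _).const_mul _),
          integral_sub (integrable_const _) (hsq.const_mul l)]
        simp only [integral_const_mul, integral_const, probReal_univ, smul_eq_mul]
        ring
    _ ≤ _ := add_one_le_exp _

theorem integral_exp_min_sq_le (hm : 1 ≤ m) (hm2 : m ≤ 2)
    (hν : Integrable (fun x => exp (|x| ^ m / 2)) ν) {l R : ℝ} (hl : 0 ≤ l) (hR : 0 < R)
    (hlR : l * R ^ (1 - m / 2) ≤ 1 / 4) :
    ∫ x, exp (l * min (x ^ 2) R) ∂ν ≤
      exp (l * ∫ x, x ^ 2 ∂ν + l ^ 2 * (6144 * ∫ x, exp (|x| ^ m / 2) ∂ν)) := by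
  have hsq := integrable_sq_of_exp_abs_rpow hm hν
  have hlin : Integrable (fun x => 1 + l * x ^ 2) ν :=
    (integrable_const _).add (hsq.const_mul l)
  have hint : Integrable (fun x => 1 + l * x ^ 2 + l ^ 2 * (6144 * exp (|x| ^ m / 2))) ν :=
    hlin.add ((hν.const_mul _).const_mul _)
  calc ∫ x, exp (l * min (x ^ 2) R) ∂ν
      ≤ ∫ x, 1 + l * x ^ 2 + l ^ 2 * (6144 * exp (|x| ^ m / 2)) ∂ν := by
        refine integral_mono_of_nonneg (Filter.Eventually.of_forall fun x => (exp_pos _).le) hint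
          (Filter.Eventually.of_forall fun x => ?_)
        have h0 : 0 ≤ |x| ^ m := by positivity
        have hy0 : 0 ≤ min (x ^ 2) R := le_min (by positivity) hR.le
        have hyx : min (x ^ 2) R ≤ x ^ 2 := min_le_left _ _
        have h1 := exp_le_one_add_add_sq_mul_exp (y := l * min (x ^ 2) R) (by positivity)
        have hly : l * min (x ^ 2) R ≤ |x| ^ m / 4 := by
          have := mul_le_mul_of_nonneg_left
            (min_sq_le_abs_rpow_mul (by linarith) hm2 hR x) hl
          nlinarith [mul_le_mul_of_nonneg_left hlR h0]
        have h2 : exp (|x| ^ m / 2) = exp (|x| ^ m / 4) * exp (|x| ^ m / 4) := by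
          rw [← exp_add]; congr 1; ring
        have h3 : min (x ^ 2) R ^ 2 * exp (l * min (x ^ 2) R) ≤ 6144 * exp (|x| ^ m / 2) := by
          calc min (x ^ 2) R ^ 2 * exp (l * min (x ^ 2) R)
              ≤ (x ^ 2) ^ 2 * exp (|x| ^ m / 4) := by gcongr
            _ = x ^ 4 * exp (|x| ^ m / 4) := by ring
            _ ≤ 6144 * exp (|x| ^ m / 4) * exp (|x| ^ m / 4) := by
                gcongr; exact pow_four_le_exp_abs_rpow hm x
            _ = _ := by rw [h2]; ring
        have h4 := mul_le_mul_of_nonneg_left h3 (sq_nonneg l)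
        have h5 := mul_le_mul_of_nonneg_left hyx hl
        simp only
        linarith [show (l * min (x ^ 2) R) ^ 2 * exp (l * min (x ^ 2) R)
          = l ^ 2 * (min (x ^ 2) R ^ 2 * exp (l * min (x ^ 2) R)) by ring]
    _ = l * ∫ x, x ^ 2 ∂ν + l ^ 2 * (6144 * ∫ x, exp (|x| ^ m / 2) ∂ν) + 1 := by
        rw [integral_add hlin ((hν.const_mul _).const_mul _),
          integral_add (integrable_const _) (hsq.const_mul l)]
        simp only [integral_const_mul, integral_const, probReal_univ, smul_eq_mul]
        ring
    _ ≤ _ := add_one_le_exp _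

theorem pi_real_le_sum_le (n : ℕ) {f : ℝ → ℝ} (hf : Integrable (fun x => exp (f x)) ν) (a : ℝ) :
    (Measure.pi fun _ : Fin n => ν).real {x | a ≤ ∑ i, f (x i)} ≤
      exp (-a) * (∫ x, exp (f x) ∂ν) ^ n := by
  have hprod : (fun x : Fin n → ℝ => exp (1 * ∑ i, f (x i))) = fun x => ∏ i, exp (f (x i)) := by
    ext x; rw [one_mul, exp_sum]
  have h := ProbabilityTheory.measure_ge_le_exp_mul_mgf (μ := Measure.pi fun _ : Fin n => ν)
    (X := fun x => ∑ i, f (x i)) (t := 1) a zero_le_one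
    (by rw [hprod]; exact Integrable.fintype_prod fun _ => hf)
  rw [ProbabilityTheory.mgf, hprod,
    integral_fintype_prod_eq_pow (f := fun x => exp (f x)), Fintype.card_fin] at h
  simpa using h

theorem pi_real_exists_lt_sq_le (hm : 1 ≤ m)
    (hν : Integrable (fun x => exp (|x| ^ m / 2)) ν) (n : ℕ) {R : ℝ} (hR : 0 ≤ R) :
    (Measure.pi fun _ : Fin n => ν).real {x | ∃ i, R < x i ^ 2} ≤
      n * (exp (-(R ^ (m / 2) / 2)) * ∫ x, exp (|x| ^ m / 2) ∂ν) := by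
  have hsub : {x : Fin n → ℝ | ∃ i, R < x i ^ 2} = ⋃ i, {x | R < x i ^ 2} := by ext; simp
  rw [hsub]
  refine (measureReal_iUnion_fintype_le _).trans ?_
  calc ∑ i : Fin n, (Measure.pi fun _ : Fin n => ν).real {x | R < x i ^ 2}
      ≤ ∑ i : Fin n, exp (-(R ^ (m / 2) / 2)) * ∫ x, exp (|x| ^ m / 2) ∂ν := by
        refine Finset.sum_le_sum fun i _ => ?_
        have hpre : {x : Fin n → ℝ | R < x i ^ 2} = Function.eval i ⁻¹' {y : ℝ | R < y ^ 2} := rfl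
        rw [hpre, (measurePreserving_eval (fun _ : Fin n => ν) i).measureReal_preimage
          (measurableSet_lt measurable_const (by fun_prop)).nullMeasurableSet]
        have h := ProbabilityTheory.measure_ge_le_exp_mul_mgf (μ := ν)
          (X := fun x => |x| ^ m / 2) (t := 1) (R ^ (m / 2) / 2) zero_le_one (by simpa using hν)
        simp only [ProbabilityTheory.mgf, one_mul, neg_mul] at h
        refine (measureReal_mono ?_).trans h
        intro y (hy : R < y ^ 2)
        have hym : (y ^ 2) ^ (m / 2) = |y| ^ m := by
          rw [← sq_abs, ← rpow_natCast, ← rpow_mul (abs_nonneg y)]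
          congr 1; push_cast; ring
        show R ^ (m / 2) / 2 ≤ |y| ^ m / 2
        rw [← hym]
        gcongr
    _ = _ := by simp

theorem pi_real_le_sum_min_sq_sub_le (hm : 1 ≤ m) (hm2 : m ≤ 2)
    (hν : Integrable (fun x => exp (|x| ^ m / 2)) ν) (n : ℕ) {l R : ℝ} (hl : 0 ≤ l)
    (hR : 0 < R) (hlR : l * R ^ (1 - m / 2) ≤ 1 / 4) (u : ℝ) :
    (Measure.pi fun _ : Fin n => ν).real
        {x | l * (n * (∫ x, x ^ 2 ∂ν) * (1 + u)) ≤ ∑ i, l * min (x i ^ 2) R} ≤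
      exp (-(l * (n * u) * ∫ x, x ^ 2 ∂ν) +
        l ^ 2 * n * (6144 * ∫ x, exp (|x| ^ m / 2) ∂ν)) := by
  have hint : Integrable (fun x => exp (l * min (x ^ 2) R)) ν := by
    refine (integrable_const (exp (l * R))).mono' (by fun_prop)
      (Filter.Eventually.of_forall fun x => ?_)
    rw [norm_of_nonneg (exp_pos _).le]
    gcongr
    exact min_le_right _ _
  refine (pi_real_le_sum_le n hint _).trans ?_
  calc _ ≤ exp (-(l * (n * (∫ x, x ^ 2 ∂ν) * (1 + u)))) *
        exp (l * ∫ x, x ^ 2 ∂ν + l ^ 2 * (6144 * ∫ x, exp (|x| ^ m / 2) ∂ν)) ^ n := by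
        gcongr
        exact integral_exp_min_sq_le hm hm2 hν hl hR hlR
    _ = _ := by
        rw [← exp_nat_mul, ← exp_add]
        congr 1
        ring

theorem pi_real_le_sum_neg_sq_le (hm : 1 ≤ m)
    (hν : Integrable (fun x => exp (|x| ^ m / 2)) ν) (n : ℕ) {l : ℝ} (hl : 0 ≤ l) (u : ℝ) :
    (Measure.pi fun _ : Fin n => ν).real
        {x | -(l * (n * (∫ x, x ^ 2 ∂ν) * (1 - u))) ≤ ∑ i, -(l * x i ^ 2)} ≤
      exp (-(l * (n * u) * ∫ x, x ^ 2 ∂ν) +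
        l ^ 2 * n * (6144 * ∫ x, exp (|x| ^ m / 2) ∂ν)) := by
  have hint : Integrable (fun x => exp (-(l * x ^ 2))) ν := by
    refine (integrable_const (1 : ℝ)).mono' (by fun_prop)
      (Filter.Eventually.of_forall fun x => ?_)
    rw [norm_of_nonneg (exp_pos _).le]
    exact exp_le_one_iff.2 (by simpa using by positivity)
  refine (pi_real_le_sum_le n (f := fun x => -(l * x ^ 2)) hint _).trans ?_
  calc _ ≤ exp (- -(l * (n * (∫ x, x ^ 2 ∂ν) * (1 - u)))) *
        exp (-(l * ∫ x, x ^ 2 ∂ν) + l ^ 2 * (6144 * ∫ x, exp (|x| ^ m / 2) ∂ν)) ^ n := by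
        gcongr
        exact integral_exp_neg_sq_le hm hν hl
    _ = _ := by
        rw [← exp_nat_mul, ← exp_add]
        congr 1
        ring

theorem natCast_mul_exp_neg_le {n z w : ℝ} (hn : n ≤ z ^ 4) (hw : w ≤ z) (hz : 0 ≤ z) :
    n * exp (-(z / 2)) ≤ 6144 * exp (-(w / 4)) := by
  calc n * exp (-(z / 2)) ≤ 6144 * exp (z / 4) * exp (-(z / 2)) := by
        gcongr; exact hn.trans (pow_four_le_exp_div_four hz)
    _ = 6144 * exp (-(z / 4)) := by
        rw [mul_assoc, ← exp_add]; congr 2; ring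
    _ ≤ _ := by gcongr

theorem pi_real_abs_sum_sq_sub_le_of_one_le (hm : 1 ≤ m) (hm2 : m ≤ 2)
    (hν : Integrable (fun x => exp (|x| ^ m / 2)) ν) {c : ℝ} (hc : 0 < c) (hc4 : c ≤ 1 / 4)
    (hcs : 2 * (6144 * ∫ x, exp (|x| ^ m / 2) ∂ν) * c ≤ ∫ x, x ^ 2 ∂ν)
    {n : ℕ} {u : ℝ} (hu0 : 0 ≤ u) (hu1 : u ≤ 1) (hw : 1 ≤ (n : ℝ) ^ (m / 2) * u ^ m) :
    (Measure.pi fun _ : Fin n => ν).real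
        {x | n * (∫ x, x ^ 2 ∂ν) * u ≤ |∑ i, x i ^ 2 - n * ∫ x, x ^ 2 ∂ν|} ≤
      2 * exp (-(c * (∫ x, x ^ 2 ∂ν) / 2 * ((n : ℝ) ^ (m / 2) * u ^ m))) +
        6144 * (∫ x, exp (|x| ^ m / 2) ∂ν) * exp (-((n : ℝ) ^ (m / 2) * u ^ m / 4)) := by
  set s := ∫ x, x ^ 2 ∂ν with hs
  set W := ∫ x, exp (|x| ^ m / 2) ∂ν with hW
  set w := (n : ℝ) ^ (m / 2) * u ^ m with hwdef
  have hW0 : 0 ≤ W := integral_nonneg fun x => (exp_pos _).le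
  have hu : 0 < u := by
    rcases hu0.eq_or_lt with rfl | h
    · rw [hwdef, zero_rpow (by linarith)] at hw; norm_num at hw
    · exact h
  have hn : (0 : ℝ) < n := by
    rcases (Nat.cast_nonneg (α := ℝ) n).eq_or_lt with h | h
    · rw [hwdef, ← h, zero_rpow (by linarith)] at hw; norm_num at hw
    · exact h
  have hwq : w = (n * u ^ 2) ^ (m / 2) := by
    rw [mul_rpow hn.le (by positivity), ← rpow_natCast u 2, ← rpow_mul hu0, hwdef]
    congr 2; push_cast; ring
  have hq1 : 1 ≤ n * u ^ 2 := by
    by_contra! h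
    have := rpow_lt_one (by positivity) h (by linarith : 0 < m / 2)
    linarith
  have hwle : w ≤ n * u ^ 2 := by
    rw [hwq]; exact rpow_le_self_of_one_le hq1 (by linarith)
  have hqR : n * u ^ 2 ≤ n * u := by
    gcongr; nlinarith
  have hR1 : 1 ≤ n * u := hq1.trans hqR
  have hR0 : 0 < n * u := by positivity
  have hwR : w ≤ (n * u) ^ (m / 2) := by
    rw [hwq]; gcongr
  have hnz : (n : ℝ) ≤ ((n * u) ^ (m / 2)) ^ 4 := by
    have h1 : ((n : ℝ) * u) ^ 2 ≤ ((n * u) ^ (m / 2)) ^ 4 := by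
      rw [← rpow_natCast, ← rpow_natCast, ← rpow_mul hR0.le]
      exact rpow_le_rpow_of_exponent_le hR1 (by push_cast; linarith)
    nlinarith
  set l := c * w / (n * u) with hl
  have hl0 : 0 ≤ l := by positivity
  have hlt : l * (n * u) = c * w := by rw [hl]; field_simp
  have hl2 : l ^ 2 * n ≤ c ^ 2 * w := by
    have : l ^ 2 * n = c ^ 2 * w * (w / (n * u ^ 2)) := by rw [hl]; field_simp
    rw [this]
    exact mul_le_of_le_one_right (by positivity) ((div_le_one (by positivity)).2 hwle)
  have hlR : l * (n * u) ^ (1 - m / 2) ≤ 1 / 4 := by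
    rw [rpow_sub hR0, rpow_one, ← mul_div_assoc, hlt, mul_div_assoc]
    exact (mul_le_of_le_one_right hc.le ((div_le_one (by positivity)).2 hwR)).trans hc4
  have hexp : exp (-(l * (n * u) * s) + l ^ 2 * n * (6144 * W)) ≤ exp (-(c * s / 2 * w)) := by
    rw [hlt]
    gcongr
    have h1 := mul_le_mul_of_nonneg_right hl2 (by positivity : 0 ≤ 6144 * W)
    have h2 := mul_le_mul_of_nonneg_left hcs (by positivity : 0 ≤ c * w)
    linarith
  have hsub : {x : Fin n → ℝ | n * s * u ≤ |∑ i, x i ^ 2 - n * s|} ⊆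
      ({x | l * (n * s * (1 + u)) ≤ ∑ i, l * min (x i ^ 2) (n * u)} ∪
        {x | -(l * (n * s * (1 - u))) ≤ ∑ i, -(l * x i ^ 2)}) ∪ {x | ∃ i, n * u < x i ^ 2} := by
    intro x (hx : n * s * u ≤ |∑ i, x i ^ 2 - n * s|)
    by_cases hmax : ∃ i, n * u < x i ^ 2
    · exact Or.inr hmax
    push Not at hmax
    left
    rcases le_abs.1 hx with h | h
    · left
      show l * (n * s * (1 + u)) ≤ ∑ i, l * min (x i ^ 2) (n * u)
      rw [← Finset.mul_sum, Finset.sum_congr rfl fun i _ => min_eq_left (hmax i)]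
      gcongr
      linarith
    · right
      show -(l * (n * s * (1 - u))) ≤ ∑ i, -(l * x i ^ 2)
      rw [Finset.sum_neg_distrib, ← Finset.mul_sum]
      gcongr
      linarith
  refine (measureReal_mono hsub).trans ((measureReal_union_le _ _).trans ?_)
  refine (add_le_add (measureReal_union_le _ _) le_rfl).trans ?_
  have h1 := (pi_real_le_sum_min_sq_sub_le hm hm2 hν n hl0 hR0 hlR u).trans hexp
  have h2 := (pi_real_le_sum_neg_sq_le hm hν n hl0 u).trans hexp
  have h3 := pi_real_exists_lt_sq_le hm hν n hR0.le
  have h4 := mul_le_mul_of_nonneg_right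
    (natCast_mul_exp_neg_le hnz hwR (by positivity)) hW0
  linarith

theorem exists_pi_real_abs_sum_sq_sub_le (hm : 1 ≤ m) (hm2 : m ≤ 2)
    (hν : Integrable (fun x => exp (|x| ^ m / 2)) ν) (hspos : 0 < ∫ x, x ^ 2 ∂ν) :
    ∃ A B : ℝ, 0 < A ∧ 0 < B ∧ ∀ (n : ℕ) (u : ℝ), 0 ≤ u → u ≤ 1 →
      (Measure.pi fun _ : Fin n => ν).real
          {x | n * (∫ x, x ^ 2 ∂ν) * u ≤ |∑ i, x i ^ 2 - n * ∫ x, x ^ 2 ∂ν|} ≤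
        A * exp (-B * (n : ℝ) ^ (m / 2) * u ^ m) := by
  set s := ∫ x, x ^ 2 ∂ν with hs
  set W := ∫ x, exp (|x| ^ m / 2) ∂ν with hW
  have hWpos : 0 < W := integral_exp_pos hν
  obtain ⟨c, hc, hc4, hcs⟩ : ∃ c : ℝ, 0 < c ∧ c ≤ 1 / 4 ∧ 2 * (6144 * W) * c ≤ s := by
    refine ⟨min (1 / 4) (s / (2 * (6144 * W))), by positivity, min_le_left _ _, ?_⟩
    rw [← le_div_iff₀' (by positivity)]
    exact min_le_right _ _
  set B := min (c * s / 2) (1 / 4) with hB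
  have hBpos : 0 < B := by positivity
  refine ⟨2 + 6144 * W + exp B, B, by positivity, hBpos, fun n u hu0 hu1 => ?_⟩
  set w := (n : ℝ) ^ (m / 2) * u ^ m with hw
  have hw0 : 0 ≤ w := by positivity
  rw [mul_assoc (-B), ← hw, neg_mul]
  rcases le_or_gt 1 w with h1 | h1
  · refine (pi_real_abs_sum_sq_sub_le_of_one_le hm hm2 hν hc hc4 hcs hu0 hu1 h1).trans ?_
    have e1 : exp (-(c * s / 2 * w)) ≤ exp (-(B * w)) := by
      gcongr; exact min_le_left _ _
    have e2 : exp (-(w / 4)) ≤ exp (-(B * w)) := by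
      gcongr; rw [div_eq_inv_mul]; gcongr; exact (min_le_right _ _).trans (by norm_num)
    have e3 := mul_le_mul_of_nonneg_left e2 (by positivity : 0 ≤ 6144 * W)
    have e4 : 0 ≤ exp B * exp (-(B * w)) := by positivity
    linarith
  · refine measureReal_le_one.trans ?_
    have e1 : 1 ≤ exp B * exp (-(B * w)) := by
      rw [← exp_add]; exact one_le_exp (by nlinarith)
    have e2 : 0 ≤ (2 + 6144 * W) * exp (-(B * w)) := by positivity
    linarith

end Concentration

theorem pi_withDensity_ofReal {ι : Type*} [Fintype ι] {f : ℝ → ℝ} (hf0 : ∀ x, 0 ≤ f x)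
    (hf : Integrable f) :
    (Measure.pi fun _ : ι => volume.withDensity fun x => ENNReal.ofReal (f x)) =
      (volume : Measure (ι → ℝ)).withDensity fun x => ENNReal.ofReal (∏ i, f (x i)) := by
  have := isFiniteMeasure_withDensity_ofReal hf.2
  refine Measure.pi_eq fun s hs => ?_
  have hind : ∀ i, Integrable ((s i).indicator f) := fun i => hf.indicator (hs i)
  have hind0 : ∀ i x, 0 ≤ (s i).indicator f x := fun i x =>
    Set.indicator_nonneg (fun x _ => hf0 x) x
  have hprod : (Set.univ.pi s).indicator (fun x => ENNReal.ofReal (∏ i, f (x i))) =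
      fun x : ι → ℝ => ENNReal.ofReal (∏ i, (s i).indicator f (x i)) := by
    ext x
    by_cases hx : x ∈ Set.univ.pi s
    · rw [Set.indicator_of_mem hx]
      congr 1
      exact Finset.prod_congr rfl fun i _ => (Set.indicator_of_mem (hx i trivial) _).symm
    · rw [Set.indicator_of_notMem hx]
      simp only [Set.mem_pi, Set.mem_univ, true_imp_iff, not_forall] at hx
      obtain ⟨i, hi⟩ := hx
      rw [Finset.prod_eq_zero (Finset.mem_univ i) (Set.indicator_of_notMem hi f),
        ENNReal.ofReal_zero]
  have hint : Integrable (fun x : ι → ℝ => ∏ i, (s i).indicator f (x i)) :=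
    Integrable.fintype_prod hind
  rw [withDensity_apply _ (MeasurableSet.univ_pi hs),
    ← lintegral_indicator (MeasurableSet.univ_pi hs), hprod,
    ← ofReal_integral_eq_lintegral_ofReal hint
      (Filter.Eventually.of_forall fun x => Finset.prod_nonneg fun i _ => hind0 i _),
    integral_fintype_prod_volume_eq_prod (fun i => (s i).indicator f),
    ENNReal.ofReal_prod_of_nonneg fun i _ => integral_nonneg (hind0 i)]
  refine Finset.prod_congr rfl fun i _ => ?_
  rw [withDensity_apply _ (hs i), ← lintegral_indicator (hs i),
    ofReal_integral_eq_lintegral_ofReal (hind i) (Filter.Eventually.of_forall (hind0 i))]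
  congr 1
  ext x
  by_cases hx : x ∈ s i <;> simp [hx]

theorem exists_median (γ : Measure ℝ) [IsFiniteMeasure γ] (hγ : γ ≠ 0) :
    ∃ τ, γ Set.univ ≤ 2 * γ (Set.Iic τ) ∧ γ Set.univ ≤ 2 * γ (Set.Ici τ) := by
  have h0 : γ Set.univ ≠ 0 := by simpa using hγ
  have hfin : γ Set.univ ≠ ⊤ := measure_ne_top _ _
  set S := {t | γ Set.univ ≤ 2 * γ (Set.Iic t)} with hS
  have hhalf : γ Set.univ / 2 < γ Set.univ := ENNReal.half_lt_self h0 hfin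
  have hle : ∀ a : ENNReal, γ Set.univ / 2 ≤ a → γ Set.univ ≤ 2 * a := fun a ha => by
    rw [mul_comm]
    exact (ENNReal.div_le_iff_le_mul (by simp) (by simp)).1 ha
  have hne : S.Nonempty := by
    obtain ⟨t, ht⟩ := ((tendsto_measure_Iic_atTop γ).eventually (lt_mem_nhds hhalf)).exists
    exact ⟨t, hle _ ht.le⟩
  have hbdd : BddBelow S := by
    obtain ⟨t, ht⟩ := ((tendsto_measure_Ici_atBot γ).eventually (lt_mem_nhds hhalf)).exists
    refine ⟨t, fun r (hr : γ Set.univ ≤ 2 * γ (Set.Iic r)) => ?_⟩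
    by_contra! hrt
    have h1 : γ (Set.Iic r) + γ (Set.Ici t) ≤ γ Set.univ := by
      rw [← measure_union (Set.Iic_disjoint_Ici.2 hrt.not_ge) measurableSet_Ici]
      exact measure_mono (Set.subset_univ _)
    have h2 : γ Set.univ / 2 ≤ γ (Set.Iic r) :=
      ENNReal.div_le_of_le_mul (by rwa [mul_comm])
    have h3 := ENNReal.add_lt_add_of_le_of_lt (by finiteness) h2 ht
    rw [ENNReal.add_halves] at h3
    exact absurd h1 (not_le.2 h3)
  refine ⟨sInf S, hle _ ?_, hle _ ?_⟩
  · have hI : ⋂ r > sInf S, Set.Iic r = Set.Iic (sInf S) := by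
      ext x
      simp only [Set.mem_iInter, Set.mem_Iic]
      exact ⟨fun h => le_of_forall_gt_imp_ge_of_dense h, fun h r hr => h.trans hr.le⟩
    have ht := tendsto_measure_biInter_gt (μ := γ) (s := fun r => Set.Iic r) (a := sInf S)
      (fun r _ => measurableSet_Iic.nullMeasurableSet) (fun i j _ hij => Set.Iic_subset_Iic.2 hij)
      ⟨sInf S + 1, by simp, measure_ne_top _ _⟩
    rw [hI] at ht
    refine ge_of_tendsto ht (Filter.eventually_of_mem self_mem_nhdsWithin fun r hr => ?_)
    obtain ⟨t, ht, htr⟩ := (csInf_lt_iff hbdd hne).1 hr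
    refine ENNReal.div_le_of_le_mul ?_
    rw [mul_comm]
    exact (show γ Set.univ ≤ 2 * γ (Set.Iic t) from ht).trans
      (by simp only [Function.comp]; gcongr)
  · have hU : Set.Iio (sInf S) = ⋃ k : ℕ, Set.Iic (sInf S - 1 / (k + 1)) := by
      ext x
      simp only [Set.mem_iUnion, Set.mem_Iio, Set.mem_Iic]
      constructor
      · intro hx
        obtain ⟨k, hk⟩ := exists_nat_one_div_lt (sub_pos.2 hx)
        exact ⟨k, by linarith⟩
      · rintro ⟨k, hk⟩
        have : (0 : ℝ) < 1 / (k + 1) := by positivity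
        linarith
    have hIio : γ (Set.Iio (sInf S)) ≤ γ Set.univ / 2 := by
      have hmono : Monotone fun k : ℕ => Set.Iic (sInf S - 1 / ((k : ℝ) + 1)) := by
        intro a b hab
        refine Set.Iic_subset_Iic.2 (sub_le_sub_left ?_ _)
        gcongr
      rw [hU, hmono.measure_iUnion]
      refine iSup_le fun k => ?_
      have hk : sInf S - 1 / ((k : ℝ) + 1) ∉ S := fun h => by
        have := csInf_le hbdd h
        have : (0 : ℝ) < 1 / (k + 1) := by positivity
        linarith
      rw [ENNReal.le_div_iff_mul_le (by simp) (by simp), mul_comm]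
      exact (not_le.1 hk).le
    have hsplit : γ (Set.Iio (sInf S)) + γ (Set.Ici (sInf S)) = γ Set.univ := by
      rw [← measure_union (Set.Iio_disjoint_Ici le_rfl) measurableSet_Ici, Set.Iio_union_Ici]
    by_contra! h
    have := ENNReal.add_lt_add_of_le_of_lt (by finiteness) hIio h
    rw [hsplit, ENNReal.add_halves] at this
    exact lt_irrefl _ this

theorem integrable_exp_neg_abs_div_two : Integrable fun x : ℝ => exp (-|x| / 2) := by
  have h1 : IntegrableOn (fun x : ℝ => exp (-|x| / 2)) (Set.Ioi 0) := by
    refine (exp_neg_integrableOn_Ioi 0 (b := 1 / 2) (by norm_num)).congr_fun (fun x hx => ?_)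
      measurableSet_Ioi
    simp only [abs_of_pos (Set.mem_Ioi.1 hx)]
    congr 1; ring
  have h2 : IntegrableOn (fun x : ℝ => exp (-|x| / 2)) (Set.Iic 0) := by
    refine (integrableOn_exp_mul_Iic (a := 1 / 2) (by norm_num) 0).congr_fun (fun x hx => ?_)
      measurableSet_Iic
    simp only [abs_of_nonpos (Set.mem_Iic.1 hx)]
    congr 1; ring
  rw [← integrableOn_univ, ← Set.Iic_union_Ioi (a := (0 : ℝ))]
  exact h2.union h1

theorem exp_half_abs_rpow_mul_exp_neg_le {p : ℝ} (hp : 1 ≤ p) (x : ℝ) :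
    exp (|x| ^ min p 2 / 2) * exp (-|x| ^ p) ≤ exp 2 * exp (-|x| / 2) := by
  rw [← exp_add, ← exp_add, exp_le_exp]
  have h1 := abs_le_one_add_abs_rpow (le_min hp (by norm_num : (1 : ℝ) ≤ 2)) x
  have h2 : |x| ^ min p 2 ≤ 1 + |x| ^ p := by
    rcases le_total |x| 1 with h | h
    · have := rpow_le_one (abs_nonneg x) h (by positivity : 0 ≤ min p 2)
      linarith [rpow_nonneg (abs_nonneg x) p]
    · linarith [rpow_le_rpow_of_exponent_le h (min_le_left p 2)]
  linarith

theorem integrable_exp_half_abs_rpow_mul_exp_neg {p : ℝ} (hp : 1 ≤ p) :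
    Integrable fun x : ℝ => exp (|x| ^ min p 2 / 2) * exp (-|x| ^ p) := by
  refine (integrable_exp_neg_abs_div_two.const_mul (exp 2)).mono' (by fun_prop)
    (Filter.Eventually.of_forall fun x => ?_)
  rw [norm_of_nonneg (by positivity)]
  exact exp_half_abs_rpow_mul_exp_neg_le hp x

theorem integrable_exp_neg_abs_rpow {p : ℝ} (hp : 1 ≤ p) :
    Integrable fun x : ℝ => exp (-|x| ^ p) := by
  refine (integrable_exp_half_abs_rpow_mul_exp_neg hp).mono'
    (Measurable.aestronglyMeasurable (by fun_prop)) (Filter.Eventually.of_forall fun x => ?_)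
  rw [norm_of_nonneg (exp_pos _).le]
  exact le_mul_of_one_le_left (exp_pos _).le (one_le_exp (by positivity))

/-- The probability measure on `ℝ` with density proportional to `exp (-|x| ^ p)`. -/
noncomputable def genGaussian (p : ℝ) : Measure ℝ :=
  volume.withDensity fun x => ENNReal.ofReal (exp (-|x| ^ p) / ∫ y, exp (-|y| ^ p))

theorem isProbabilityMeasure_genGaussian {p : ℝ} (hp : 1 ≤ p) :
    IsProbabilityMeasure (genGaussian p) where
  measure_univ := by
    have hint := integrable_exp_neg_abs_rpow hp
    have hpos := integral_exp_pos hint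
    rw [genGaussian, withDensity_apply _ MeasurableSet.univ, Measure.restrict_univ,
      ← ofReal_integral_eq_lintegral_ofReal (hint.div_const _)
        (Filter.Eventually.of_forall fun x => by positivity),
      integral_div, div_self hpos.ne', ENNReal.ofReal_one]

theorem integrable_exp_half_abs_rpow_genGaussian {p : ℝ} (hp : 1 ≤ p) :
    Integrable (fun x => exp (|x| ^ min p 2 / 2)) (genGaussian p) := by
  have hpos := integral_exp_pos (integrable_exp_neg_abs_rpow hp)
  rw [genGaussian, integrable_withDensity_iff_integrable_smul' (by fun_prop) (by simp)]
  refine ((integrable_exp_half_abs_rpow_mul_exp_neg hp).div_const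
    (∫ y, exp (-|y| ^ p))).congr (Filter.Eventually.of_forall fun x => ?_)
  simp only
  rw [ENNReal.toReal_ofReal (by positivity), smul_eq_mul]
  ring

theorem integral_sq_genGaussian_pos {p : ℝ} (hp : 1 ≤ p) : 0 < ∫ x, x ^ 2 ∂genGaussian p := by
  have := isProbabilityMeasure_genGaussian hp
  have hint := integrable_sq_of_exp_abs_rpow (le_min hp (by norm_num : (1 : ℝ) ≤ 2))
    (integrable_exp_half_abs_rpow_genGaussian hp)
  rw [integral_pos_iff_support_of_nonneg (fun x => sq_nonneg x) hint]
  have hsupp : Function.support (fun x : ℝ => x ^ 2) = {0}ᶜ := by ext; simp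
  have h0 : genGaussian p {0} = 0 := withDensity_absolutelyContinuous _ _ (by simp)
  rw [hsupp, prob_compl_eq_one_sub (measurableSet_singleton 0), h0]
  simp

section Representation

variable {n : ℕ} {p : ℝ}

theorem ofReal_exp_neg_eq_lintegral {a : ℝ} (ha : 0 ≤ a) :
    ENNReal.ofReal (exp (-a)) =
      ∫⁻ t in Set.Ioi 0, ENNReal.ofReal (exp (-t)) * (Set.Ici a).indicator 1 t := by
  have hint : IntegrableOn (fun t => exp (-t)) (Set.Ioi a) := integrableOn_exp_neg_Ioi a
  have hind : (fun t => ENNReal.ofReal (exp (-t)) * (Set.Ici a).indicator 1 t) =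
      (Set.Ici a).indicator fun t => ENNReal.ofReal (exp (-t)) := by
    ext t; by_cases ht : t ∈ Set.Ici a <;> simp [ht]
  rw [hind, lintegral_indicator measurableSet_Ici, Measure.restrict_restrict measurableSet_Ici]
  have hae : (Set.Ici a ∩ Set.Ioi 0 : Set ℝ) =ᵐ[volume] Set.Ioi a := by
    have h : Set.Ioi a ∩ Set.Ioi 0 = Set.Ioi a :=
      Set.inter_eq_left.2 (Set.Ioi_subset_Ioi ha)
    rw [← h]
    exact Ioi_ae_eq_Ici.symm.inter (Filter.EventuallyEq.refl _ _)
  rw [setLIntegral_congr hae, ← ofReal_integral_eq_lintegral_ofReal hint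
    (Filter.Eventually.of_forall fun t => (exp_pos _).le), integral_exp_neg_Ioi]

theorem setLIntegral_exp_neg_eq_lintegral {E : Type*} [MeasurableSpace E] {μ : Measure E}
    [SFinite μ] {N : E → ℝ} (hN : Measurable N) (hN0 : ∀ x, 0 ≤ N x) (S : Set E) :
    ∫⁻ x in S, ENNReal.ofReal (exp (-N x)) ∂μ =
      ∫⁻ t in Set.Ioi 0, ENNReal.ofReal (exp (-t)) * μ (S ∩ {x | N x ≤ t}) := by
  simp_rw [fun x => ofReal_exp_neg_eq_lintegral (hN0 x)]
  have hmeas : Measurable fun z : E × ℝ => (Set.Ici (N z.1)).indicator (1 : ℝ → ENNReal) z.2 := by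
    have h : (fun z : E × ℝ => (Set.Ici (N z.1)).indicator (1 : ℝ → ENNReal) z.2) =
        {z : E × ℝ | N z.1 ≤ z.2}.indicator 1 := by
      ext z; simp [Set.indicator]
    rw [h]
    exact measurable_one.indicator (measurableSet_le (by fun_prop) measurable_snd)
  rw [lintegral_lintegral_swap (by
    refine Measurable.aemeasurable (Measurable.mul (by fun_prop) hmeas))]
  refine lintegral_congr fun t => ?_
  rw [lintegral_const_mul' _ _ (by finiteness)]
  congr 1
  have h : (fun x => (Set.Ici (N x)).indicator (1 : ℝ → ENNReal) t) =
      {x | N x ≤ t}.indicator 1 := by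
    ext x; simp [Set.indicator]
  have hm : MeasurableSet {x | N x ≤ t} := measurableSet_le hN measurable_const
  rw [h, lintegral_indicator_one hm, Measure.restrict_apply hm, Set.inter_comm]

theorem volume_inter_setOf_sum_le (hp : 0 < p) {t : ℝ} (ht : 0 < t)
    (S : Set (EuclideanSpace ℝ (Fin n))) :
    volume (S ∩ {x | ∑ i, |x i| ^ p ≤ t}) =
      ENNReal.ofReal ((t ^ (1 / p)) ^ n) *
        volume ((fun y => t ^ (1 / p) • y) ⁻¹' S ∩ lpBall n p) := by
  have hr : 0 < t ^ (1 / p) := by positivity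
  have hpre : (fun y => t ^ (1 / p) • y) ⁻¹' S ∩ lpBall n p =
      (fun y => t ^ (1 / p) • y) ⁻¹' (S ∩ {x | ∑ i, |x i| ^ p ≤ t}) := by
    ext y
    have h : ∑ i, |(t ^ (1 / p) • y) i| ^ p = t * ∑ i, |y i| ^ p := by
      rw [Finset.mul_sum]
      refine Finset.sum_congr rfl fun i _ => ?_
      rw [PiLp.smul_apply, smul_eq_mul, abs_mul, abs_of_pos hr,
        mul_rpow hr.le (abs_nonneg _), ← rpow_mul ht.le, one_div_mul_cancel hp.ne', rpow_one]
    simp only [Set.mem_inter_iff, Set.mem_preimage, lpBall, Set.mem_ofPred_eq, h]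
    rw [mul_le_iff_le_one_right ht]
  rw [hpre, Measure.addHaar_preimage_smul _ hr.ne', finrank_euclideanSpace_fin, ← mul_assoc,
    ← ENNReal.ofReal_mul (by positivity), abs_of_pos (by positivity),
    mul_inv_cancel₀ (by positivity), ENNReal.ofReal_one, one_mul]

theorem pi_genGaussian_preimage_toLp (hp : 1 ≤ p) {S : Set (EuclideanSpace ℝ (Fin n))}
    (hS : MeasurableSet S) :
    (Measure.pi fun _ : Fin n => genGaussian p) (WithLp.toLp 2 ⁻¹' S) =
      ENNReal.ofReal ((∫ y, exp (-|y| ^ p)) ^ n)⁻¹ *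
        ∫⁻ x in S, ENNReal.ofReal (exp (-∑ i, |x i| ^ p)) := by
  have hint := integrable_exp_neg_abs_rpow hp
  have hpos := integral_exp_pos hint
  have hmp := PiLp.volume_preserving_toLp (Fin n)
  have hfun : (fun x : Fin n → ℝ => ENNReal.ofReal (∏ i, exp (-|x i| ^ p) / ∫ y, exp (-|y| ^ p))) =
      fun x => ENNReal.ofReal ((∫ y, exp (-|y| ^ p)) ^ n)⁻¹ *
        ENNReal.ofReal (exp (-∑ i, |(WithLp.toLp 2 x : EuclideanSpace ℝ (Fin n)) i| ^ p)) := by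
    ext x
    rw [← ENNReal.ofReal_mul (by positivity), Finset.prod_div_distrib, ← exp_sum,
      Finset.sum_neg_distrib, Finset.prod_const, Finset.card_univ, Fintype.card_fin,
      div_eq_inv_mul]
  simp only [genGaussian]
  rw [pi_withDensity_ofReal (fun x => by positivity) (hint.div_const _), hfun,
    withDensity_apply _ (hmp.measurable hS), lintegral_const_mul _ (by fun_prop),
    ← hmp.setLIntegral_comp_preimage hS (by fun_prop)]

theorem exists_radial_measure (hp : 1 ≤ p) (n : ℕ) :
    ∃ γ : Measure ℝ, γ (Set.Iic 0) = 0 ∧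
      ∀ S : Set (EuclideanSpace ℝ (Fin n)), MeasurableSet S →
        (Measure.pi fun _ : Fin n => genGaussian p) (WithLp.toLp 2 ⁻¹' S) =
          ∫⁻ t, volume ((fun y => t ^ (1 / p) • y) ⁻¹' S ∩ lpBall n p) ∂γ := by
  set z := ENNReal.ofReal ((∫ y, exp (-|y| ^ p)) ^ n)⁻¹ with hz
  refine ⟨(volume.restrict (Set.Ioi 0)).withDensity fun t =>
    z * (ENNReal.ofReal (exp (-t)) * ENNReal.ofReal ((t ^ (1 / p)) ^ n)), ?_, fun S hS => ?_⟩
  · refine withDensity_absolutelyContinuous _ _ ?_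
    rw [Measure.restrict_apply measurableSet_Iic, Set.Iic_inter_Ioi]
    simp
  · rw [lintegral_withDensity_eq_lintegral_mul_non_measurable _ (by fun_prop)
      (Filter.Eventually.of_forall fun t => by finiteness), pi_genGaussian_preimage_toLp hp hS,
      setLIntegral_exp_neg_eq_lintegral (N := fun x => ∑ i, |x i| ^ p) (by fun_prop)
        (fun x => by positivity) S, ← lintegral_const_mul' _ _ (by finiteness)]
    refine setLIntegral_congr_fun measurableSet_Ioi fun t ht => ?_
    simp only [Pi.mul_apply]
    rw [volume_inter_setOf_sum_le (by linarith) ht]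
    ring

theorem exists_volume_inter_lpBall_le (hp : 1 ≤ p) (n : ℕ) :
    ∃ r : ℝ, 0 < r ∧
      (∀ a : ℝ, volume ({x | a < r * ‖x‖} ∩ lpBall n p) ≤
        2 * (Measure.pi fun _ : Fin n => genGaussian p) {x | a < ‖WithLp.toLp 2 x‖} *
          volume (lpBall n p)) ∧
      ∀ a : ℝ, volume ({x | r * ‖x‖ < a} ∩ lpBall n p) ≤
        2 * (Measure.pi fun _ : Fin n => genGaussian p) {x | ‖WithLp.toLp 2 x‖ < a} *
          volume (lpBall n p) := by
  have := isProbabilityMeasure_genGaussian hp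
  obtain ⟨γ, hγ0, hγ⟩ := exists_radial_measure hp n
  have huniv : γ Set.univ * volume (lpBall n p) = 1 := by
    have h := hγ Set.univ MeasurableSet.univ
    simp only [Set.preimage_univ, measure_univ, Set.univ_inter, lintegral_const] at h
    rw [h, mul_comm]
  have hγfin : IsFiniteMeasure γ := ⟨by
    rw [lt_top_iff_ne_top]
    intro h
    rw [h, ENNReal.top_mul (by intro h0; simp [h0] at huniv)] at huniv
    exact ENNReal.top_ne_one huniv⟩
  have hγne : γ ≠ 0 := by rintro rfl; simp at huniv
  obtain ⟨τ, hτ1, hτ2⟩ := exists_median γ hγne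
  have hτ : 0 < τ := by
    by_contra! h
    rw [measure_mono_null (Set.Iic_subset_Iic.2 h) hγ0, mul_zero] at hτ1
    exact hγne (by simpa using hτ1)
  have hIoc : γ (Set.Iic τ) = γ (Set.Ioc 0 τ) := by
    rw [← Set.Iic_union_Ioc_eq_Iic hτ.le]
    refine le_antisymm ((measure_union_le _ _).trans (by rw [hγ0, zero_add])) ?_
    exact measure_mono Set.subset_union_right
  have key : ∀ (I : Set ℝ) (S T : Set (EuclideanSpace ℝ (Fin n))), MeasurableSet I →
      MeasurableSet S → γ Set.univ ≤ 2 * γ I →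
      (∀ t ∈ I, T ⊆ (fun y => t ^ (1 / p) • y) ⁻¹' S) →
      volume (T ∩ lpBall n p) ≤
        2 * (Measure.pi fun _ : Fin n => genGaussian p) (WithLp.toLp 2 ⁻¹' S) *
          volume (lpBall n p) := by
    intro I S T hI hS hhalf hsub
    have h1 : volume (T ∩ lpBall n p) * γ I ≤
        (Measure.pi fun _ : Fin n => genGaussian p) (WithLp.toLp 2 ⁻¹' S) := by
      rw [hγ S hS, ← setLIntegral_const]
      refine (setLIntegral_mono' hI fun t ht => ?_).trans (setLIntegral_le_lintegral I _)
      exact measure_mono (Set.inter_subset_inter_left _ (hsub t ht))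
    calc volume (T ∩ lpBall n p)
        = volume (T ∩ lpBall n p) * (γ Set.univ * volume (lpBall n p)) := by
          rw [huniv, mul_one]
      _ ≤ volume (T ∩ lpBall n p) * (2 * γ I * volume (lpBall n p)) := by gcongr
      _ = 2 * (volume (T ∩ lpBall n p) * γ I) * volume (lpBall n p) := by ring
      _ ≤ _ := by gcongr
  have hnorm : ∀ t : ℝ, 0 < t → ∀ x : EuclideanSpace ℝ (Fin n),
      ‖t ^ (1 / p) • x‖ = t ^ (1 / p) * ‖x‖ := fun t ht x => by
    rw [norm_smul, norm_of_nonneg (by positivity)]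
  refine ⟨τ ^ (1 / p), by positivity, fun a => ?_, fun a => ?_⟩
  · refine key (Set.Ici τ) {x | a < ‖x‖} _ measurableSet_Ici
      (measurableSet_lt measurable_const measurable_norm) hτ2 fun t ht x hx => ?_
    have ht : τ ≤ t := ht
    show a < ‖t ^ (1 / p) • x‖
    rw [hnorm t (hτ.trans_le ht)]
    refine (show a < τ ^ (1 / p) * ‖x‖ from hx).trans_le ?_
    gcongr
  · refine key (Set.Ioc 0 τ) {x | ‖x‖ < a} _ measurableSet_Ioc
      (measurableSet_lt measurable_norm measurable_const) (by rwa [← hIoc])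
      fun t ht x hx => ?_
    show ‖t ^ (1 / p) • x‖ < a
    rw [hnorm t ht.1]
    refine lt_of_le_of_lt ?_ (show τ ^ (1 / p) * ‖x‖ < a from hx)
    have := ht.1
    have := ht.2
    gcongr

end Representation

theorem stmt19 (p : ℝ) (hp : 1 ≤ p) :
    ∃ A B : ℝ, 0 < A ∧ 0 < B ∧
      ∀ (n : ℕ), 1 ≤ n →
        ∃ C : ℝ, 0 < C ∧
          ∀ u ∈ Set.Icc (0:ℝ) 1,
            volMeasure (lpBall n p) {x | u < |‖x‖ / C - 1|} ≤
              A * Real.exp (-B * (n : ℝ) ^ (min p 2 / 2) * u ^ min p 2) := by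
  have := isProbabilityMeasure_genGaussian hp
  have hs := integral_sq_genGaussian_pos hp
  obtain ⟨A, B, hA, hB, hAB⟩ := exists_pi_real_abs_sum_sq_sub_le
    (le_min hp (by norm_num : (1 : ℝ) ≤ 2)) (min_le_right p 2)
    (integrable_exp_half_abs_rpow_genGaussian hp) hs
  set s := ∫ x, x ^ 2 ∂genGaussian p
  refine ⟨4 * A, B, by positivity, hB, fun n hn => ?_⟩
  obtain ⟨r, hr, hgt, hlt⟩ := exists_volume_inter_lpBall_le hp n
  have hn0 : (0 : ℝ) < n := by exact_mod_cast hn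
  have hns : 0 < n * s := by positivity
  have hM : 0 < √(n * s) := sqrt_pos.2 hns
  have hM2 : √(n * s) ^ 2 = n * s := sq_sqrt hns.le
  refine ⟨√(n * s) / r, by positivity, fun u ⟨hu0, hu1⟩ => ?_⟩
  set P := Measure.pi fun _ : Fin n => genGaussian p
  set D := {x : Fin n → ℝ | n * s * u ≤ |∑ i, x i ^ 2 - n * s|} with hD
  have hnorm : ∀ x : Fin n → ℝ, ‖WithLp.toLp 2 x‖ ^ 2 = ∑ i, x i ^ 2 := fun x => by
    rw [EuclideanSpace.norm_sq_eq]
    simp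
  have hup : {x : Fin n → ℝ | √(n * s) * (1 + u) < ‖WithLp.toLp 2 x‖} ⊆ D := by
    intro x (hx : √(n * s) * (1 + u) < ‖WithLp.toLp 2 x‖)
    have h := pow_le_pow_left₀ (by positivity) hx.le 2
    rw [hnorm, mul_pow, hM2] at h
    change n * s * u ≤ |∑ i, x i ^ 2 - n * s|
    refine le_abs.2 (Or.inl ?_)
    nlinarith [mul_nonneg hns.le (add_nonneg hu0 (sq_nonneg u))]
  have hlow : {x : Fin n → ℝ | ‖WithLp.toLp 2 x‖ < √(n * s) * (1 - u)} ⊆ D := by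
    intro x (hx : ‖WithLp.toLp 2 x‖ < √(n * s) * (1 - u))
    have h := pow_le_pow_left₀ (norm_nonneg _) hx.le 2
    rw [hnorm, mul_pow, hM2] at h
    change n * s * u ≤ |∑ i, x i ^ 2 - n * s|
    refine le_abs.2 (Or.inr ?_)
    nlinarith [mul_nonneg hns.le (mul_nonneg hu0 (sub_nonneg.2 hu1))]
  have hsub : {x : EuclideanSpace ℝ (Fin n) | u < |‖x‖ / (√(n * s) / r) - 1|} ⊆
      {x | √(n * s) * (1 + u) < r * ‖x‖} ∪ {x | r * ‖x‖ < √(n * s) * (1 - u)} := by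
    intro x (hx : u < |‖x‖ / (√(n * s) / r) - 1|)
    have he : ‖x‖ / (√(n * s) / r) = r * ‖x‖ / √(n * s) := by field_simp
    rw [he] at hx
    rcases lt_abs.1 hx with h | h
    · left
      rw [Set.mem_ofPred_eq, mul_comm, ← lt_div_iff₀ hM]
      linarith
    · right
      rw [Set.mem_ofPred_eq, mul_comm √(n * s), ← div_lt_iff₀ hM]
      linarith
  have hvol : volume ({x | u < |‖x‖ / (√(n * s) / r) - 1|} ∩ lpBall n p) ≤
      4 * P D * volume (lpBall n p) := by
    refine (measure_mono (Set.inter_subset_inter_left _ hsub)).trans ?_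
    rw [Set.union_inter_distrib_right]
    refine (measure_union_le _ _).trans ?_
    calc _ ≤ 2 * P D * volume (lpBall n p) + 2 * P D * volume (lpBall n p) := by
          refine add_le_add ((hgt _).trans ?_) ((hlt _).trans ?_) <;> gcongr
      _ = _ := by ring
  calc volMeasure (lpBall n p) {x | u < |‖x‖ / (√(n * s) / r) - 1|}
      ≤ (4 * P D).toReal :=
        ENNReal.toReal_mono (by finiteness) (ENNReal.div_le_of_le_mul hvol)
    _ = 4 * P.real D := by simp [measureReal_def]
    _ ≤ 4 * (A * exp (-B * (n : ℝ) ^ (min p 2 / 2) * u ^ min p 2)) := by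
        gcongr
        exact hAB n u hu0 hu1
    _ = _ := by ring
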